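/- Suppose p(p+1)/2 > rank(𝒜) (the rank of 𝒜 as a linear map on Sym(n,ℝ)) and that for every Y ∈ ℳ_p the matrices A_1 Y, …, A_m Y are linearly independent. Then there exists a set N ⊆ Sym(n,ℝ) of Lebesgue (additive Haar) measure zero in the finite-dimensional real vector space Sym(n,ℝ) such that for every cost matrix C ∉ N, every second-order critical point Y ∈ ℳ_p (i.e., S(Y)Y = 0 and ⟨Ẏ, S(Y)Ẏ⟩ ≥ 0 for all Ẏ with ⟨A_i Y, Ẏ⟩ = 0 for all i) is globally optimal for the factorized problem, and X = YYᵀ is globally optimal for the SDP. -/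

import Mathlib

open Matrix MeasureTheory

noncomputable section

/-- Frobenius inner product ⟨A,B⟩ = trace(AᵀB). -/
def ip {n p : ℕ} (A B : Matrix (Fin n) (Fin p) ℝ) : ℝ := Matrix.trace (Aᵀ * B)

/-- The constraint map 𝒜(X)ᵢ = trace(Aᵢ X). -/
def calA {n m : ℕ} (A : Fin m → Matrix (Fin n) (Fin n) ℝ) (X : Matrix (Fin n) (Fin n) ℝ) :
    Fin m → ℝ := fun i => Matrix.trace (A i * X)

/-- The adjoint 𝒜*(ν) = ∑ νᵢ Aᵢ. -/
def adjA {n m : ℕ} (A : Fin m → Matrix (Fin n) (Fin n) ℝ) (ν : Fin m → ℝ) :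
    Matrix (Fin n) (Fin n) ℝ := ∑ i, ν i • A i

/-- ℳ_p = {Y ∈ ℝ^{n×p} : 𝒜(YYᵀ) = b}. -/
def MM {n m : ℕ} (A : Fin m → Matrix (Fin n) (Fin n) ℝ) (b : Fin m → ℝ) (p : ℕ) :
    Set (Matrix (Fin n) (Fin p) ℝ) := {Y | calA A (Y * Yᵀ) = b}

/-- 𝒞 = {X ∈ Sym(n,ℝ) : 𝒜(X) = b, X ⪰ 0}. -/
def CC {n m : ℕ} (A : Fin m → Matrix (Fin n) (Fin n) ℝ) (b : Fin m → ℝ) :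
    Set (Matrix (Fin n) (Fin n) ℝ) := {X | X.IsSymm ∧ calA A X = b ∧ X.PosSemidef}

/-- Gram matrix G(Y)ᵢⱼ = ⟨AᵢY, AⱼY⟩. -/
def gram {n m p : ℕ} (A : Fin m → Matrix (Fin n) (Fin n) ℝ) (Y : Matrix (Fin n) (Fin p) ℝ) :
    Matrix (Fin m) (Fin m) ℝ := Matrix.of fun i j => ip (A i * Y) (A j * Y)

/-- S(Y) = C − 𝒜*(G(Y)⁻¹ 𝒜(C Y Yᵀ)). -/
def Smat {n m p : ℕ} (A : Fin m → Matrix (Fin n) (Fin n) ℝ) (C : Matrix (Fin n) (Fin n) ℝ)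
    (Y : Matrix (Fin n) (Fin p) ℝ) : Matrix (Fin n) (Fin n) ℝ :=
  C - adjA A ((gram A Y)⁻¹ *ᵥ calA A (C * (Y * Yᵀ)))

/-- Frobenius norm. -/
def frob {a c : ℕ} (M : Matrix (Fin a) (Fin c) ℝ) : ℝ := Real.sqrt (∑ i, ∑ j, (M i j) ^ 2)


/-- A smooth image of a lower-dimensional space is a null set. -/
lemma volume_range_eq_zero_of_finrank_lt {n : ℕ} {E : Type*} [NormedAddCommGroup E]
    [NormedSpace ℝ E] [FiniteDimensional ℝ E] {f : E → Fin n → Fin n → ℝ} (hf : ContDiff ℝ 1 f)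
    (h : Module.finrank ℝ E < n * n) : volume (Set.range f) = 0 := by
  have hfin : Module.finrank ℝ (Fin n → Fin n → ℝ) = n * n := by
    simp [Module.finrank_pi_fintype]
  have hd : dimH (Set.range f) <
      ((Module.finrank ℝ (Fin n → Fin n → ℝ) : NNReal) : ENNReal) := by
    refine hf.dimH_range_le.trans_lt ?_
    rw [hfin]
    exact_mod_cast h
  have h0 := hausdorffMeasure_of_dimH_lt hd
  have hinv : (Measure.pi fun _ : Fin n => (volume : Measure (Fin n → ℝ))).IsAddLeftInvariant :=
    inferInstance
  have hac : (Measure.pi fun _ : Fin n => (volume : Measure (Fin n → ℝ))) ≪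
      Measure.hausdorffMeasure (Module.finrank ℝ (Fin n → Fin n → ℝ) : ℝ) :=
    Measure.absolutelyContinuous_isAddHaarMeasure _ _
  exact hac (by simpa using h0)

/-- The skew-symmetric matrices. -/
def skewSubmodule (n : ℕ) : Submodule ℝ (Fin n → Fin n → ℝ) where
  carrier := {M | ∀ i j, M i j + M j i = 0}
  add_mem' {M N} hM hN i j := by
    have := hM i j
    have := hN i j
    simp only [Pi.add_apply]
    linarith
  zero_mem' i j := by simp
  smul_mem' c M hM i j := by
    simp only [Pi.smul_apply, smul_eq_mul, ← mul_add, hM i j, mul_zero]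

/-- The symmetric matrix with prescribed entries. -/
def symLinearMap (n : ℕ) : (Sym2 (Fin n) → ℝ) →ₗ[ℝ] (Fin n → Fin n → ℝ) where
  toFun t i j := t s(i, j)
  map_add' _ _ := rfl
  map_smul' _ _ := rfl

lemma finrank_skewSubmodule_add_le (n : ℕ) :
    Module.finrank ℝ (skewSubmodule n) + (n + 1).choose 2 ≤ n * n := by
  have hinj : Function.Injective (symLinearMap n) := by
    intro s t h
    ext z
    induction z with
    | _ i j => exact congrFun (congrFun h i) j
  have hr : Module.finrank ℝ (LinearMap.range (symLinearMap n)) = (n + 1).choose 2 := by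
    rw [LinearMap.finrank_range_of_inj hinj]
    simp [Sym2.card]
  have hdisj : Disjoint (skewSubmodule n) (LinearMap.range (symLinearMap n)) := by
    rw [Submodule.disjoint_def]
    rintro _ hM ⟨t, rfl⟩
    ext i j
    have := hM i j
    simp only [symLinearMap, LinearMap.coe_mk, AddHom.coe_mk, Sym2.eq_swap (a := j)] at this
    simp only [symLinearMap, LinearMap.coe_mk, AddHom.coe_mk, Pi.zero_apply]
    linarith
  have h := Submodule.finrank_add_finrank_le_of_disjoint hdisj
  rw [hr] at h
  simpa [Module.finrank_pi_fintype] using h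

/-- A matrix with injective `mulVec` has an invertible square submatrix of full size. -/
lemma exists_isUnit_submatrix {n p : ℕ} (Y : Matrix (Fin n) (Fin p) ℝ)
    (hY : Function.Injective Y.mulVec) :
    ∃ a : Fin p ↪ Fin n, IsUnit (Y.submatrix a id) := by
  obtain ⟨κ, a, ha, hspan, hli⟩ := exists_linearIndependent' ℝ Y.row
  have : Finite κ := Finite.of_injective a ha
  have := Fintype.ofFinite κ
  have hrank : Y.rank = p := by
    rw [Matrix.rank, LinearMap.finrank_range_of_inj (by exact hY)]
    simp
  have hcard : Fintype.card κ = p := by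
    rw [← finrank_span_eq_card hli, hspan, ← Matrix.rank_eq_finrank_span_row, hrank]
  let e : Fin p ≃ κ := (Fintype.equivFinOfCardEq hcard).symm
  refine ⟨⟨a ∘ e, ha.comp e.injective⟩, ?_⟩
  rw [← Matrix.linearIndependent_rows_iff_isUnit]
  exact hli.comp e e.injective

/-- The rows, indexed by the complement of the range of `a`, of the projection along the graph
of `Z`. -/
def graphRow {n p : ℕ} (a : Fin p ↪ Fin n) (Z : {i // i ∉ Set.range a} → Fin p → ℝ)
    (k : {i // i ∉ Set.range a}) (i : Fin n) : ℝ :=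
  (if k.1 = i then 1 else 0) - ∑ x, Z k x * (if a x = i then 1 else 0)

/-- Parametrization of the matrices whose symmetric part is, up to an element of `U`, symmetric
with a kernel that is the graph of a map from the coordinates `a` to the others. -/
def corankParam {n p : ℕ} (a : Fin p ↪ Fin n) (U : Submodule ℝ (Fin n → Fin n → ℝ))
    (x : (Sym2 {i // i ∉ Set.range a} → ℝ) × ({i // i ∉ Set.range a} → Fin p → ℝ) × U) :
    Fin n → Fin n → ℝ :=
  fun i j => (∑ k, ∑ l, graphRow a x.2.1 k i * x.1 s(k, l) * graphRow a x.2.1 l j)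
    + (x.2.2 : Fin n → Fin n → ℝ) i j

lemma contDiff_corankParam {n p : ℕ} (a : Fin p ↪ Fin n)
    (U : Submodule ℝ (Fin n → Fin n → ℝ)) : ContDiff ℝ 1 (corankParam a U) := by
  have hU : ContDiff ℝ 1 fun x : (Sym2 {i // i ∉ Set.range a} → ℝ) ×
      ({i // i ∉ Set.range a} → Fin p → ℝ) × U => (x.2.2 : Fin n → Fin n → ℝ) :=
    U.subtypeL.contDiff.comp (contDiff_snd.comp contDiff_snd)
  refine contDiff_pi.2 fun i => contDiff_pi.2 fun j => ?_
  unfold corankParam graphRow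
  refine ContDiff.add ?_ (contDiff_pi.1 (contDiff_pi.1 hU i) j)
  fun_prop

/-- A symmetric matrix annihilating `Y`, where the rows `a` of `Y` form an invertible matrix, is
determined by its other rows and columns. -/
lemma exists_eq_graphRow {n p : ℕ} (a : Fin p ↪ Fin n) (S : Matrix (Fin n) (Fin n) ℝ)
    (hS : S.IsSymm) (Y : Matrix (Fin n) (Fin p) ℝ) (hSY : S * Y = 0)
    (ha : IsUnit (Y.submatrix a id)) :
    ∃ (t : Sym2 {i // i ∉ Set.range a} → ℝ) (Z : {i // i ∉ Set.range a} → Fin p → ℝ),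
      ∀ i j, S i j = ∑ k, ∑ l, graphRow a Z k i * t s(k, l) * graphRow a Z l j := by
  set B := Y.submatrix a id with hB
  set W : Matrix (Fin n) (Fin p) ℝ := Y * B⁻¹ with hW
  have hSW : S * W = 0 := by rw [hW, ← Matrix.mul_assoc, hSY, Matrix.zero_mul]
  have hWa : W.submatrix a id = 1 := by
    have : W.submatrix a id = B * B⁻¹ := rfl
    rw [this, Matrix.mul_nonsing_inv _ ((Matrix.isUnit_iff_isUnit_det _).1 ha)]
  let E : Matrix (Fin p) (Fin n) ℝ := Matrix.of fun x i => if a x = i then 1 else 0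
  let P : Matrix (Fin n) (Fin n) ℝ := 1 - W * E
  have hSP : S * P = S := by
    rw [Matrix.mul_sub, ← Matrix.mul_assoc, hSW, Matrix.mul_one, Matrix.zero_mul, sub_zero]
  have hPSP : Pᵀ * S * P = S := by
    rw [Matrix.mul_assoc, hSP]
    calc Pᵀ * S = (S * P)ᵀ := by rw [Matrix.transpose_mul, hS.eq]
      _ = S := by rw [hSP, hS.eq]
  have hP0 : ∀ k ∈ Set.range a, ∀ i, P k i = 0 := by
    rintro _ ⟨x, rfl⟩ i
    have hWx : ∀ y, W (a x) y = (1 : Matrix (Fin p) (Fin p) ℝ) x y := fun y =>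
      congrFun (congrFun hWa x) y
    have hWE : (W * E) (a x) i = E x i := by
      simp_rw [Matrix.mul_apply, hWx]
      rw [← Matrix.mul_apply, Matrix.one_mul]
    simp only [P, E, Matrix.sub_apply, hWE, Matrix.one_apply, Matrix.of_apply, sub_self]
  refine ⟨fun z => Sym2.lift ⟨fun k l => S k.1 l.1, fun k l => (hS.apply _ _).symm⟩ z,
    fun k x => W k.1 x, fun i j => ?_⟩
  have hrow : ∀ k i, graphRow a (fun k x => W k.1 x) k i = P k.1 i := fun k i => by
    simp [graphRow, P, E, Matrix.sub_apply, Matrix.mul_apply, Matrix.one_apply]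
  have hsum : ∀ g : Fin n → ℝ, (∀ k ∈ Set.range a, g k = 0) →
      ∑ k, g k = ∑ k : {i // i ∉ Set.range a}, g k.1 := fun g hg => by
    rw [← Fintype.sum_subtype_add_sum_subtype (· ∈ Set.range a) g,
      Finset.sum_eq_zero (fun k _ => hg k.1 k.2), zero_add]
  simp only [hrow, Sym2.lift_mk]
  conv_lhs => rw [← hPSP, Matrix.mul_assoc]
  rw [Matrix.mul_apply, hsum _ fun k hk => by simp [hP0 k hk]]
  refine Finset.sum_congr rfl fun k _ => ?_
  rw [Matrix.mul_apply, Finset.mul_sum, hsum _ fun l hl => by simp [hP0 l hl]]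
  exact Finset.sum_congr rfl fun l _ => by rw [Matrix.transpose_apply, mul_assoc]

/-- The symmetric matrices which are, up to the span of the `A i`, annihilating `p` independent
vectors. -/
def degenerateCosts {n m : ℕ} (A : Fin m → Matrix (Fin n) (Fin n) ℝ) (p : ℕ) :
    Set (Matrix (Fin n) (Fin n) ℝ) :=
  {C | C.IsSymm ∧ ∃ S : Matrix (Fin n) (Fin n) ℝ, S.IsSymm ∧
    ∃ Y : Matrix (Fin n) (Fin p) ℝ, Function.Injective Y.mulVec ∧ S * Y = 0 ∧
    ∃ ν, C = S + adjA A ν}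

lemma volume_preimage_degenerateCosts {n m p : ℕ} (A : Fin m → Matrix (Fin n) (Fin n) ℝ)
    (hrank : 2 * Module.finrank ℝ (Submodule.span ℝ (Set.range A)) < p * (p + 1)) :
    volume (Matrix.of ⁻¹' {M : Matrix (Fin n) (Fin n) ℝ | M + Mᵀ ∈ degenerateCosts A p}) = 0 := by
  let V : Submodule ℝ (Fin n → Fin n → ℝ) := Submodule.span ℝ (Set.range A)
  let U := V ⊔ skewSubmodule n
  have hV : 2 * Module.finrank ℝ V < p * (p + 1) := hrank
  have hU : Module.finrank ℝ U ≤ Module.finrank ℝ V + Module.finrank ℝ (skewSubmodule n) :=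
    Submodule.finrank_add_le_finrank_add_finrank _ _
  have hK := finrank_skewSubmodule_add_le n
  have key : ∀ a : Fin p ↪ Fin n, volume (Set.range (corankParam a U)) = 0 := fun a => by
    refine volume_range_eq_zero_of_finrank_lt (contDiff_corankParam a U) ?_
    have hpn : p ≤ n := by simpa using Fintype.card_le_of_embedding a
    have hc : Fintype.card {i // i ∉ Set.range a} = n - p := by
      rw [Fintype.card_subtype_compl, Fintype.card_fin, Set.card_range_of_injective a.injective,
        Fintype.card_fin]
    obtain ⟨q, rfl⟩ := Nat.exists_eq_add_of_le hpn
    simp only [Module.finrank_prod, Module.finrank_pi_fintype, Module.finrank_self,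
      Finset.sum_const, Finset.card_univ, smul_eq_mul, mul_one, Sym2.card, hc, Fintype.card_fin,
      Nat.add_sub_cancel_left]
    have h1 : 2 * (q + 1).choose 2 = (q + 1) * q := by
      rw [Nat.choose_two_right,
        Nat.mul_div_cancel' (Nat.even_mul_pred_self (q + 1)).two_dvd, Nat.add_sub_cancel]
    have h2 : 2 * (p + q + 1).choose 2 = (p + q + 1) * (p + q) := by
      rw [Nat.choose_two_right,
        Nat.mul_div_cancel' (Nat.even_mul_pred_self (p + q + 1)).two_dvd, Nat.add_sub_cancel]
    nlinarith
  refine measure_mono_null ?_ (measure_iUnion_null key)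
  rintro M ⟨-, S, hS, Y, hY, hSY, ν, hν⟩
  obtain ⟨a, ha⟩ := exists_isUnit_submatrix Y hY
  obtain ⟨t, Z, htZ⟩ := exists_eq_graphRow a S hS Y hSY ha
  let D : Fin n → Fin n → ℝ := adjA A ν
  have hνV : D ∈ V :=
    Submodule.sum_mem _ fun i _ => Submodule.smul_mem _ _ (Submodule.subset_span ⟨i, rfl⟩)
  have hskew : (fun i j => (M i j - M j i) / 2) ∈ skewSubmodule n := fun i j => by ring
  refine Set.mem_iUnion.2 ⟨a, ⟨(1 / 2 : ℝ) • t, Z, ⟨(1 / 2 : ℝ) • D +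
    fun i j => (M i j - M j i) / 2, Submodule.add_mem_sup (V.smul_mem _ hνV) hskew⟩⟩, ?_⟩
  ext i j
  have h1 : M i j + M j i = S i j + adjA A ν i j := congrFun (congrFun hν i) j
  have h2 : ∑ k, ∑ l, graphRow a Z k i * ((1 / 2 : ℝ) • t) s(k, l) * graphRow a Z l j =
      1 / 2 * S i j := by
    rw [htZ i j, Finset.mul_sum]
    refine Finset.sum_congr rfl fun k _ => ?_
    rw [Finset.mul_sum]
    refine Finset.sum_congr rfl fun l _ => ?_
    rw [Pi.smul_apply, smul_eq_mul]
    ring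
  have h3 : corankParam a U ((1 / 2 : ℝ) • t, Z, ⟨(1 / 2 : ℝ) • D +
    fun i j => (M i j - M j i) / 2, Submodule.add_mem_sup (V.smul_mem _ hνV) hskew⟩) i j =
      (∑ k, ∑ l, graphRow a Z k i * ((1 / 2 : ℝ) • t) s(k, l) * graphRow a Z l j) +
      (1 / 2 * adjA A ν i j + (M i j - M j i) / 2) := rfl
  rw [h3, h2]
  linarith

lemma isSymm_adjA {n m : ℕ} {A : Fin m → Matrix (Fin n) (Fin n) ℝ} (hA : ∀ i, (A i).IsSymm)
    (ν : Fin m → ℝ) : (adjA A ν).IsSymm := by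
  simp only [adjA, Matrix.IsSymm, Matrix.transpose_sum, Matrix.transpose_smul, (hA _).eq]

lemma trace_adjA_mul {n m : ℕ} (A : Fin m → Matrix (Fin n) (Fin n) ℝ) (ν : Fin m → ℝ)
    (X : Matrix (Fin n) (Fin n) ℝ) : (adjA A ν * X).trace = ν ⬝ᵥ calA A X := by
  simp [adjA, calA, Finset.sum_mul, Matrix.trace_sum, dotProduct]

lemma trace_mul_nonneg_of_posSemidef {n : ℕ} {S X : Matrix (Fin n) (Fin n) ℝ}
    (hS : S.PosSemidef) (hX : X.PosSemidef) : 0 ≤ (S * X).trace := by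
  obtain ⟨B, rfl⟩ : ∃ B, X = Bᴴ * B := by
    open scoped MatrixOrder in
    exact CStarAlgebra.nonneg_iff_eq_star_mul_self.1 hX.nonneg
  rw [← Matrix.mul_assoc, Matrix.trace_mul_comm, ← Matrix.mul_assoc]
  exact (hS.mul_mul_conjTranspose_same B).trace_nonneg

/-- At a rank-deficient second-order critical point the dual certificate is positive
semidefinite. -/
lemma posSemidef_of_mulVec_eq_zero {n m p : ℕ} {A : Fin m → Matrix (Fin n) (Fin n) ℝ}
    {S : Matrix (Fin n) (Fin n) ℝ} (hS : S.IsSymm) {Y : Matrix (Fin n) (Fin p) ℝ}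
    (h : ∀ V : Matrix (Fin n) (Fin p) ℝ, (∀ i, ip (A i * Y) V = 0) → 0 ≤ ip V (S * V))
    {z : Fin p → ℝ} (hz : z ≠ 0) (hYz : Y *ᵥ z = 0) : S.PosSemidef := by
  refine .of_dotProduct_mulVec_nonneg (by simpa [Matrix.IsHermitian] using hS.eq) fun x => ?_
  have hpos : 0 < z ⬝ᵥ z := by simpa using dotProduct_star_self_pos_iff.2 hz
  have h1 := h (vecMulVec x z) fun i => by
    rw [ip, Matrix.mul_vecMulVec, Matrix.trace_vecMulVec, Matrix.mulVec_transpose,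
      ← Matrix.dotProduct_mulVec, ← Matrix.mulVec_mulVec, hYz, Matrix.mulVec_zero,
      dotProduct_zero]
  have h2 : ip (vecMulVec x z) (S * vecMulVec x z) = (z ⬝ᵥ z) * (x ⬝ᵥ S *ᵥ x) := by
    rw [ip, Matrix.mul_vecMulVec, Matrix.transpose_vecMulVec, Matrix.vecMulVec_mul_vecMulVec]
    simp [Matrix.trace_vecMulVec, mul_comm]
  rw [h2] at h1
  simpa using nonneg_of_mul_nonneg_right h1 hpos

lemma ip_mul_self_eq_trace {n p : ℕ} (C : Matrix (Fin n) (Fin n) ℝ)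
    (Y : Matrix (Fin n) (Fin p) ℝ) : ip (C * Y) Y = (Cᵀ * (Y * Yᵀ)).trace := by
  rw [ip, Matrix.transpose_mul, Matrix.mul_assoc, Matrix.trace_mul_comm, Matrix.mul_assoc]

lemma mul_transpose_mem_CC {n m p : ℕ} {A : Fin m → Matrix (Fin n) (Fin n) ℝ} {b : Fin m → ℝ}
    {Y : Matrix (Fin n) (Fin p) ℝ} (hY : Y ∈ MM A b p) : Y * Yᵀ ∈ CC A b :=
  ⟨by simp [Matrix.IsSymm], hY, by simpa using Matrix.posSemidef_self_mul_conjTranspose Y⟩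

/-- Theorem 1.4 of the paper: if p(p+1)/2 > rank 𝒜 and Assumption 1a
holds at p, then for almost every symmetric cost matrix C (outside a set N of symmetric
matrices which is Lebesgue-null — encoded here by saying that the preimage of N under
the surjective linear parametrization M ↦ M + Mᵀ of Sym(n,ℝ) has measure zero), every
second-order critical point Y of the factorized problem is globally optimal and
X = YYᵀ is globally optimal for the SDP. Since the Aᵢ are symmetric, the rank of the
constraint map 𝒜 on Sym(n,ℝ) equals dim span{A₁,…,Aₘ}. -/
theorem stmt10 (n m p : ℕ) (hn : 1 ≤ n) (hm : 1 ≤ m) (hp : 1 ≤ p)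
    (A : Fin m → Matrix (Fin n) (Fin n) ℝ) (hA : ∀ i, (A i).IsSymm) (b : Fin m → ℝ)
    (hrank : 2 * Module.finrank ℝ (Submodule.span ℝ (Set.range A)) < p * (p + 1))
    (hli : ∀ Y ∈ MM A b p, LinearIndependent ℝ (fun i => A i * Y)) :
    ∃ N : Set (Matrix (Fin n) (Fin n) ℝ),
      (∀ C ∈ N, C.IsSymm) ∧
      volume (Matrix.of ⁻¹' {M : Matrix (Fin n) (Fin n) ℝ | M + Mᵀ ∈ N}) = 0 ∧
      (∀ C : Matrix (Fin n) (Fin n) ℝ, C.IsSymm → C ∉ N →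
        ∀ Y ∈ MM A b p,
          (Smat A C Y * Y = 0 ∧
            ∀ V : Matrix (Fin n) (Fin p) ℝ, (∀ i, ip (A i * Y) V = 0) →
              0 ≤ ip V (Smat A C Y * V)) →
          (∀ Y' ∈ MM A b p, ip (C * Y) Y ≤ ip (C * Y') Y') ∧
          (∀ X' ∈ CC A b, Matrix.trace (Cᵀ * (Y * Yᵀ)) ≤ Matrix.trace (Cᵀ * X'))) := by
  refine ⟨degenerateCosts A p, fun C hC => hC.1, volume_preimage_degenerateCosts A hrank, ?_⟩
  rintro C hC hCN Y hY ⟨hSY, hsoc⟩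
  set μ := (gram A Y)⁻¹ *ᵥ calA A (C * (Y * Yᵀ)) with hμ
  have hSdef : Smat A C Y = C - adjA A μ := rfl
  have hSsymm : (Smat A C Y).IsSymm := hSdef ▸ hC.sub (isSymm_adjA hA μ)
  have hdef : ¬ Function.Injective Y.mulVec := fun hinj =>
    hCN ⟨hC, Smat A C Y, hSsymm, Y, hinj, hSY, μ, by rw [hSdef, sub_add_cancel]⟩
  obtain ⟨z, hYz, hz⟩ : ∃ z, Y *ᵥ z = 0 ∧ z ≠ 0 := by
    by_contra! h
    exact hdef ((injective_iff_map_eq_zero Y.mulVecLin).2 h)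
  have hpsd := posSemidef_of_mulVec_eq_zero hSsymm hsoc hz hYz
  have hC' : Cᵀ = Smat A C Y + adjA A μ := by rw [hSdef, sub_add_cancel, hC.eq]
  have hopt : ∀ X ∈ CC A b, Matrix.trace (Cᵀ * (Y * Yᵀ)) ≤ Matrix.trace (Cᵀ * X) := by
    rintro X ⟨-, hX, hXpsd⟩
    have hYb : calA A (Y * Yᵀ) = b := hY
    rw [hC', Matrix.add_mul, Matrix.add_mul, Matrix.trace_add, Matrix.trace_add, trace_adjA_mul,
      trace_adjA_mul, hX, hYb, ← Matrix.mul_assoc, hSY, Matrix.zero_mul, Matrix.trace_zero]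
    exact add_le_add_left (trace_mul_nonneg_of_posSemidef hpsd hXpsd) _
  refine ⟨fun Y' hY' => ?_, hopt⟩
  rw [ip_mul_self_eq_trace, ip_mul_self_eq_trace]
  exact hopt _ (mul_transpose_mem_CC hY')
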